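/- Let X and Y be finite T0 topological spaces. Then for (a,b), (c,d) ∈ X × Y, the furtherness in the product space satisfies Ψ_{X×Y}((a,b),(c,d)) = Ψ_X(a,c)·|U_d| + Ψ_Y(b,d)·|U_c| − Ψ_X(a,c)·Ψ_Y(b,d). -/

import Mathlib

open Set Topology

/-- The minimal open set containing `x`: the intersection of all open sets containing `x`. -/
def minOpen (X : Type*) [TopologicalSpace X] (x : X) : Set X :=
  ⋂₀ {U : Set X | IsOpen U ∧ x ∈ U}

/-- A nested sequence of open sets around `x`: a sequence of open sets starting at the
minimal open set of `x`, increasing, strictly increasing until it reaches the whole space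
(after which it is stationary), with no open set strictly between consecutive terms. -/
def NestedSeq (X : Type*) [TopologicalSpace X] (x : X) (c : ℕ → Set X) : Prop :=
  c 0 = minOpen X x ∧ (∀ j, IsOpen (c j)) ∧
  (∀ j, c j ⊆ c (j + 1)) ∧
  (∀ j, c j ≠ c (j + 1) ∨ c j = Set.univ) ∧
  (∀ j, ∀ V : Set X, IsOpen V → c j ⊆ V → V ⊆ c (j + 1) → V = c j ∨ V = c (j + 1))

/-- The furtherness `Ψ(x,y)`: the least `k` such that `y` belongs to the `k`-th term of
some nested sequence of open sets around `x`. -/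
noncomputable def furth (X : Type*) [TopologicalSpace X] (x y : X) : ℕ :=
  sInf {k | ∃ c : ℕ → Set X, NestedSeq X x c ∧ y ∈ c k}

theorem minOpen_isOpen (X : Type*) [TopologicalSpace X] [Finite X] (x : X) :
    IsOpen (minOpen X x) :=
  Set.Finite.isOpen_sInter (Set.toFinite _) (fun _ h => h.1)

theorem mem_minOpen (X : Type*) [TopologicalSpace X] (x : X) : x ∈ minOpen X x := by
  intro U hU
  exact hU.2

theorem minOpen_sub (X : Type*) [TopologicalSpace X] {x : X} {U : Set X} (hU : IsOpen U)
    (hx : x ∈ U) : minOpen X x ⊆ U := fun _ hy => hy U ⟨hU, hx⟩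

theorem exists_insert_open (X : Type*) [TopologicalSpace X] [Finite X] [T0Space X]
    {V W : Set X} (hV : IsOpen V) (hW : IsOpen W) (hne : ¬ W ⊆ V) :
    ∃ p ∈ W, p ∉ V ∧ IsOpen (insert p V) := by
  obtain ⟨p0, hp0W, hp0V⟩ := Set.not_subset.1 hne
  obtain ⟨p, ⟨hpW, hpV⟩, hmin⟩ := Set.exists_min_image (W \ V)
    (fun p => (minOpen X p).ncard) (Set.toFinite _) ⟨p0, hp0W, hp0V⟩
  refine ⟨p, hpW, hpV, ?_⟩
  have hsub : ∀ q ∈ minOpen X p, q = p ∨ q ∈ V := by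
    intro q hq
    by_contra! hcon
    have hqW : q ∈ W := minOpen_sub X hW hpW hq
    have h1 := hmin q ⟨hqW, hcon.2⟩
    have h2 : minOpen X q ⊆ minOpen X p := minOpen_sub X (minOpen_isOpen X p) hq
    have h3 := Set.eq_of_subset_of_ncard_le h2 h1 (Set.toFinite _)
    apply hcon.1
    apply T0Space.t0
    rw [inseparable_iff_forall_isOpen]
    intro U hU
    constructor
    · intro h
      exact minOpen_sub X hU h (h3 ▸ mem_minOpen X p)
    · intro h
      exact minOpen_sub X hU h hq
  have : insert p V = V ∪ minOpen X p := by
    ext q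
    constructor
    · rintro (rfl | h)
      · exact Or.inr (mem_minOpen X _)
      · exact Or.inl h
    · rintro (h | h)
      · exact Or.inr h
      · exact hsub q h
  rw [this]
  exact hV.union (minOpen_isOpen X p)

theorem exists_next (X : Type*) [TopologicalSpace X] [Finite X] [T0Space X]
    {W : Set X} (hW : IsOpen W) (V : {V : Set X // IsOpen V}) :
    ∃ V' : {V : Set X // IsOpen V}, V.1 ⊆ V'.1 ∧ (V.1 ≠ V'.1 ∨ V.1 = Set.univ) ∧
      (∀ S : Set X, V.1 ⊆ S → S ⊆ V'.1 → S = V.1 ∨ S = V'.1) ∧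
      (V.1 ⊆ W → V.1 ≠ W → V'.1 ⊆ W ∧ V'.1.ncard = V.1.ncard + 1) := by
  obtain ⟨V, hV⟩ := V
  have key : ∀ p, p ∉ V → V ⊆ insert p V ∧ V ≠ insert p V ∧
      (∀ S : Set X, V ⊆ S → S ⊆ insert p V → S = V ∨ S = insert p V) := by
    intro p hp
    refine ⟨Set.subset_insert _ _, ?_, ?_⟩
    · intro h
      exact hp (h ▸ Set.mem_insert p V)
    · intro S h1 h2
      by_cases hpS : p ∈ S
      · right
        exact h2.antisymm (Set.insert_subset hpS h1)
      · left
        refine Set.Subset.antisymm (fun q hq => ?_) h1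
        rcases h2 hq with rfl | h
        · exact absurd hq hpS
        · exact h
  by_cases h : V ⊆ W ∧ V ≠ W
  · obtain ⟨p, hpW, hpV, ho⟩ := exists_insert_open X hV hW
      (fun h' => h.2 (h.1.antisymm h'))
    obtain ⟨k1, k2, k3⟩ := key p hpV
    exact ⟨⟨insert p V, ho⟩, k1, Or.inl k2, k3, fun _ _ =>
      ⟨Set.insert_subset hpW h.1, Set.ncard_insert_of_notMem hpV (Set.toFinite _)⟩⟩
  · by_cases hu : V = Set.univ
    · exact ⟨⟨V, hV⟩, subset_rfl, Or.inr hu, fun S h1 h2 => Or.inl (h2.antisymm h1),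
        fun h1 h2 => absurd ⟨h1, h2⟩ h⟩
    · obtain ⟨p, hpW, hpV, ho⟩ := exists_insert_open X hV isOpen_univ
        (fun h' => hu (Set.univ_subset_iff.1 h'))
      obtain ⟨k1, k2, k3⟩ := key p hpV
      exact ⟨⟨insert p V, ho⟩, k1, Or.inl k2, k3, fun h1 h2 => absurd ⟨h1, h2⟩ h⟩

theorem furth_eq (X : Type*) [TopologicalSpace X] [Finite X] [T0Space X] (x y : X) :
    furth X x y = (minOpen X y \ minOpen X x).ncard := by
  have hmem : ∃ s : ℕ → Set X, NestedSeq X x s ∧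
      y ∈ s (minOpen X y \ minOpen X x).ncard := by
    have hW : IsOpen (minOpen X x ∪ minOpen X y) :=
      (minOpen_isOpen X x).union (minOpen_isOpen X y)
    choose f h1 h2 h3 h4 using exists_next X hW
    let s : ℕ → {V : Set X // IsOpen V} := fun n => f^[n] ⟨minOpen X x, minOpen_isOpen X x⟩
    have hs : ∀ n, s (n + 1) = f (s n) := fun n => Function.iterate_succ_apply' f n _
    have hWc : (minOpen X x ∪ minOpen X y).ncard =
        (minOpen X x).ncard + (minOpen X y \ minOpen X x).ncard := by
      rw [← Set.union_diff_self, Set.ncard_union_eq Set.disjoint_sdiff_right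
        (Set.toFinite _) (Set.toFinite _)]
    refine ⟨fun n => (s n).1, ⟨rfl, fun j => (s j).2, ?_, ?_, ?_⟩, ?_⟩
    · intro j
      simp only [hs]
      exact h1 _
    · intro j
      simp only [hs]
      exact h2 _
    · intro j V _
      simp only [hs]
      exact h3 _ V
    · have main : ∀ n, n ≤ (minOpen X y \ minOpen X x).ncard →
          (s n).1 ⊆ minOpen X x ∪ minOpen X y ∧ (s n).1.ncard = (minOpen X x).ncard + n := by
        intro n
        induction n with
        | zero => exact fun _ => ⟨Set.subset_union_left, rfl⟩
        | succ n ih =>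
          intro hn
          obtain ⟨i1, i2⟩ := ih (by omega)
          obtain ⟨j1, j2⟩ := h4 (s n) i1 (fun h => by rw [h] at i2; omega)
          rw [hs]
          exact ⟨j1, by omega⟩
      obtain ⟨m1, m2⟩ := main _ le_rfl
      have := Set.eq_of_subset_of_ncard_le m1 (by omega) (Set.toFinite _)
      simp only [this]
      exact Or.inr (mem_minOpen X y)
  apply le_antisymm
  · exact Nat.sInf_le hmem
  · have hne : {k | ∃ c : ℕ → Set X, NestedSeq X x c ∧ y ∈ c k}.Nonempty := ⟨_, hmem⟩
    refine le_csInf hne ?_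
    rintro k ⟨s, ⟨s0, s1, s2, s3, s4⟩, hy⟩
    have hc : ∀ n, minOpen X x ⊆ s n ∧ (s n).ncard ≤ (minOpen X x).ncard + n := by
      intro n
      induction n with
      | zero => rw [s0]; exact ⟨subset_rfl, le_rfl⟩
      | succ n ih =>
        refine ⟨ih.1.trans (s2 n), ?_⟩
        by_cases hsub : s (n + 1) ⊆ s n
        · have := Set.ncard_le_ncard hsub (Set.toFinite _)
          omega
        · obtain ⟨p, hp, hpn, ho⟩ := exists_insert_open X (s1 n) (s1 (n + 1)) hsub
          have hcard := Set.ncard_insert_of_notMem hpn (Set.toFinite _)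
          rcases s4 n _ ho (Set.subset_insert _ _) (Set.insert_subset hp (s2 n)) with h | h
          · exact absurd (h ▸ Set.mem_insert p (s n)) hpn
          · rw [← h]
            omega
    obtain ⟨c1, c2⟩ := hc k
    have e1 : (minOpen X y \ minOpen X x).ncard ≤ (s k \ minOpen X x).ncard :=
      Set.ncard_le_ncard (Set.diff_subset_diff_left (minOpen_sub X (s1 k) hy)) (Set.toFinite _)
    have e2 := Set.ncard_diff_add_ncard_of_subset c1 (Set.toFinite _)
    omega

theorem minOpen_prod (X Y : Type*) [TopologicalSpace X] [TopologicalSpace Y] [Finite X]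
    [Finite Y] (a : X) (b : Y) :
    minOpen (X × Y) (a, b) = minOpen X a ×ˢ minOpen Y b := by
  apply Set.Subset.antisymm
  · exact minOpen_sub _ ((minOpen_isOpen X a).prod (minOpen_isOpen Y b))
      ⟨mem_minOpen X a, mem_minOpen Y b⟩
  · rintro ⟨p, q⟩ ⟨hp, hq⟩ U ⟨hU, hab⟩
    obtain ⟨u, v, hu, hv, hau, hbv, huv⟩ := isOpen_prod_iff.1 hU a b hab
    exact huv ⟨minOpen_sub X hu hau hp, minOpen_sub Y hv hbv hq⟩

theorem stmt11 (X Y : Type*) [TopologicalSpace X] [TopologicalSpace Y] [Finite X] [Finite Y]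
    [T0Space X] [T0Space Y] (a c : X) (b d : Y) :
    furth (X × Y) (a, b) (c, d) =
      furth X a c * (minOpen Y d).ncard + furth Y b d * (minOpen X c).ncard
        - furth X a c * furth Y b d := by
  rw [furth_eq, furth_eq, furth_eq, minOpen_prod, minOpen_prod]
  have h1 := Set.ncard_inter_add_ncard_diff_eq_ncard (minOpen X c) (minOpen X a) (Set.toFinite _)
  have h2 := Set.ncard_inter_add_ncard_diff_eq_ncard (minOpen Y d) (minOpen Y b) (Set.toFinite _)
  have h3 := Set.ncard_inter_add_ncard_diff_eq_ncard (minOpen X c ×ˢ minOpen Y d)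
    (minOpen X a ×ˢ minOpen Y b) (Set.toFinite _)
  rw [Set.prod_inter_prod, Set.ncard_prod, Set.ncard_prod, ← h1, ← h2] at h3
  rw [← h1, ← h2]
  apply Nat.eq_sub_of_add_eq
  nlinarith [h3]
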